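/- arXiv:2504.02944 — 2 statements merged into one kernel-verified Lean document; each statement's English description precedes it below -/
import Mathlib

section
/- Let d ≥ 1, let A and X be finite sets, let p : A × X → ℝ satisfy p(a|x) > 0 for all a,x and ∑_{a∈A} p(a|x) = 1 for every x, and let ρ_{a|x} (a ∈ A, x ∈ X) be density matrices on ℂ^d (positive semidefinite with trace 1). Then the following are equivalent: (i) [the multi-source {p(a|x)ρ_{a|x}} is classical] there exist a finite index set Λ, density matrices σ_λ on ℂ^d, and nonnegative reals m_x(a,λ) with ∑_{a,λ} m_x(a,λ) = 1 for each x, such that p(a|x) • ρ_{a|x} = ∑_λ m_x(a,λ) • σ_λ for all a,x, and such that for every α : A × X → ℝ with ∑_{a,x} α(a,x) p(a|x) • ρ_{a|x} = 0 one has ∑_{a,x} α(a,x) m_x(a,λ) = 0 for every λ; (ii) the set of states (ρ_{a|x})_{(a,x) ∈ A × X} is classical. -/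
open Matrix BigOperators
open scoped ComplexOrder

noncomputable section

/-- The noncontextual preparation-assignment polytope of a set of states. -/
def statesPolytope {d : ℕ} {A : Type*} [Fintype A]
    (ρ : A → Matrix (Fin d) (Fin d) ℂ) : Set (A → ℝ) :=
  {q | (∀ a, 0 ≤ q a) ∧ (∑ a : A, q a = 1) ∧
    ∀ α : A → ℝ, (∑ a : A, α a • ρ a = 0) → (∑ a : A, α a * q a = 0)}

/-- A set of states is classical. -/
def IsClassicalStates {d : ℕ} {A : Type*} [Fintype A]
    (ρ : A → Matrix (Fin d) (Fin d) ℂ) : Prop :=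
  ∃ (n : ℕ) (σ : Fin n → Matrix (Fin d) (Fin d) ℂ) (q : Fin n → A → ℝ),
    (∀ l, (σ l).PosSemidef) ∧
    (∀ l, q l ∈ statesPolytope ρ) ∧
    (∀ a : A, ρ a = ∑ l, q l a • σ l)

theorem multiSource_classical_iff_states_classical
    {d : ℕ} (hd : 1 ≤ d) {A X : Type*} [Fintype A] [Fintype X]
    (p : A × X → ℝ)
    (hp_pos : ∀ q, 0 < p q)
    (hp_norm : ∀ x : X, ∑ a : A, p (a, x) = 1)
    (ρ : A × X → Matrix (Fin d) (Fin d) ℂ)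
    (hpsd : ∀ q, (ρ q).PosSemidef)
    (htr : ∀ q, (ρ q).trace = 1) :
    (∃ (n : ℕ) (σ : Fin n → Matrix (Fin d) (Fin d) ℂ) (m : X → A → Fin n → ℝ),
        (∀ l, (σ l).PosSemidef) ∧ (∀ l, (σ l).trace = 1) ∧
        (∀ x a l, 0 ≤ m x a l) ∧
        (∀ x : X, ∑ a : A, ∑ l, m x a l = 1) ∧
        (∀ a : A, ∀ x : X, p (a, x) • ρ (a, x) = ∑ l, m x a l • σ l) ∧
        (∀ α : A × X → ℝ,
          (∑ q : A × X, α q • (p q • ρ q) = 0) →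
            ∀ l, ∑ q : A × X, α q * m q.2 q.1 l = 0)) ↔
      IsClassicalStates ρ := by
  classical
  by_cases hne : IsEmpty (A × X)
  · have hX : IsEmpty X := by
      refine ⟨fun x => ?_⟩
      have h := hp_norm x
      have hA : IsEmpty A := ⟨fun a => hne.false (a, x)⟩
      simp at h
    constructor
    · intro _
      exact ⟨0, Fin.elim0, Fin.elim0, fun l => l.elim0, fun l => l.elim0,
        fun a => hne.elim a⟩
    · intro _
      exact ⟨0, Fin.elim0, fun _ _ l => l.elim0, fun l => l.elim0, fun l => l.elim0,
        fun x => hX.elim x, fun x => hX.elim x, fun _ x => hX.elim x, fun _ _ l => l.elim0⟩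
  rw [not_isEmpty_iff] at hne
  obtain ⟨q0⟩ := hne
  constructor
  · rintro ⟨n, σ, m, hσ, hσt, hm, hms, hdec, hα⟩
    have hpn : ∀ q, p q ≠ 0 := fun q => (hp_pos q).ne'
    let S : Fin n → ℝ := fun l => ∑ q : A × X, m q.2 q.1 l / p q
    have hterm : ∀ l q, 0 ≤ m q.2 q.1 l / p q := fun l q =>
      div_nonneg (hm _ _ _) (hp_pos q).le
    have hS : ∀ l, 0 ≤ S l := fun l => Finset.sum_nonneg fun q _ => hterm l q
    have hN : (0 : ℝ) < Fintype.card (A × X) := by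
      exact_mod_cast Fintype.card_pos_iff.mpr ⟨q0⟩
    refine ⟨n, fun l => S l • σ l, fun l q =>
      if S l = 0 then (Fintype.card (A × X) : ℝ)⁻¹ else m q.2 q.1 l / p q / S l, ?_, ?_, ?_⟩
    · intro l
      exact (hσ l).smul (hS l)
    · intro l
      by_cases h0 : S l = 0
      · simp only [h0, if_true]
        refine ⟨fun _ => by positivity, ?_, ?_⟩
        · simp only [Finset.sum_const, Finset.card_univ, nsmul_eq_mul]
          exact mul_inv_cancel₀ hN.ne'
        · intro α h
          have h1 := congrArg Matrix.trace h
          simp only [Matrix.trace_sum, Matrix.trace_smul, htr, Matrix.trace_zero] at h1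
          have h2 : ∑ q, α q = 0 := by
            have h3 := congrArg Complex.re h1
            simpa using h3
          rw [← Finset.sum_mul, h2, zero_mul]
      · simp only [h0, if_false]
        refine ⟨fun q => div_nonneg (hterm l q) (hS l), ?_, ?_⟩
        · rw [← Finset.sum_div]
          exact div_self h0
        · intro α h
          have h1 := hα (fun q => α q / p q) (by
            rw [← h]
            refine Finset.sum_congr rfl fun q _ => ?_
            rw [smul_smul, div_mul_cancel₀ _ (hpn q)]) l
          have h2 : ∑ q, α q * (m q.2 q.1 l / p q / S l)
              = (∑ q, α q / p q * m q.2 q.1 l) / S l := by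
            rw [Finset.sum_div]
            refine Finset.sum_congr rfl fun q _ => ?_
            ring
          rw [h2, h1, zero_div]
    · rintro ⟨a, x⟩
      have h1 : ρ (a, x) = (p (a, x))⁻¹ • (p (a, x) • ρ (a, x)) := by
        rw [smul_smul, inv_mul_cancel₀ (hpn _), one_smul]
      rw [h1, hdec, Finset.smul_sum]
      refine Finset.sum_congr rfl fun l _ => ?_
      rw [smul_smul, smul_smul]
      congr 1
      by_cases h0 : S l = 0
      · have h2 := (Finset.sum_eq_zero_iff_of_nonneg (fun q _ => hterm l q)).mp h0 (a, x)
          (Finset.mem_univ _)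
        simp only [h0, mul_zero]
        rw [← h2]
        simp only
        ring
      · simp only [h0, if_false]
        rw [div_mul_cancel₀ _ h0]
        ring
  · rintro ⟨n, σ, q, hσ, hq, hdec⟩
    let t : Fin n → ℝ := fun l => (σ l).trace.re
    have htc : ∀ l, (σ l).trace = (t l : ℂ) := by
      intro l
      have h := (hσ l).trace_nonneg
      rw [Complex.le_def] at h
      apply Complex.ext
      · simp [t]
      · simpa using h.2.symm
    have ht : ∀ l, 0 ≤ t l := by
      intro l
      have h := (hσ l).trace_nonneg
      rw [Complex.le_def] at h
      simpa using h.1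
    let τ : Fin n → Matrix (Fin d) (Fin d) ℂ := fun l =>
      if t l = 0 then ρ q0 else (t l)⁻¹ • σ l
    have hτ : ∀ l, σ l = t l • τ l := by
      intro l
      by_cases h0 : t l = 0
      · have h1 : σ l = 0 := (hσ l).trace_eq_zero_iff.mp (by rw [htc, h0]; simp)
        rw [h0, zero_smul, h1]
      · simp only [τ, h0, if_false]
        rw [smul_smul, mul_inv_cancel₀ h0, one_smul]
    refine ⟨n, τ, fun x a l => p (a, x) * q l (a, x) * t l, ?_, ?_, ?_, ?_, ?_, ?_⟩
    · intro l
      by_cases h0 : t l = 0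
      · simp only [τ, h0, if_true]; exact hpsd q0
      · simp only [τ, h0, if_false]; exact (hσ l).smul (inv_nonneg.mpr (ht l))
    · intro l
      by_cases h0 : t l = 0
      · simp only [τ, h0, if_true]; exact htr q0
      · simp only [τ, h0, if_false]
        rw [Matrix.trace_smul, htc, Complex.real_smul, ← Complex.ofReal_mul,
          inv_mul_cancel₀ h0, Complex.ofReal_one]
    · intro x a l
      exact mul_nonneg (mul_nonneg (hp_pos _).le ((hq l).1 _)) (ht l)
    · intro x
      rw [← hp_norm x]
      refine Finset.sum_congr rfl fun a _ => ?_
      have h1 := congrArg Matrix.trace (hdec (a, x))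
      simp only [Matrix.trace_sum, Matrix.trace_smul, htr, htc] at h1
      have h2 : (1 : ℝ) = ∑ l, q l (a, x) * t l := by
        have h3 := congrArg Complex.re h1
        simpa using h3
      simp only [mul_assoc]
      rw [← Finset.mul_sum, ← h2, mul_one]
    · intro a x
      conv_lhs => rw [hdec (a, x)]
      rw [Finset.smul_sum]
      refine Finset.sum_congr rfl fun l _ => ?_
      conv_lhs => rw [hτ l]
      rw [smul_smul, smul_smul]
    · intro α h l
      have h1 := (hq l).2.2 (fun z => α z * p z) (by
        rw [← h]
        refine Finset.sum_congr rfl fun z _ => ?_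
        rw [smul_smul])
      have h2 : ∑ z : A × X, α z * (p (z.1, z.2) * q l (z.1, z.2) * t l)
          = (∑ z, α z * p z * q l z) * t l := by
        rw [Finset.sum_mul]
        refine Finset.sum_congr rfl fun z _ => ?_
        simp only [Prod.mk.eta]
        ring
      exact h2.trans (by rw [h1, zero_mul])
end
end

section
/- Let ρ be a density matrix on ℂ² ⊗ ℂ², i.e. a positive semidefinite complex matrix indexed by (Fin 2 × Fin 2) × (Fin 2 × Fin 2) with trace 1. Call ρ separable if there exist a finite set I and positive semidefinite 2×2 complex matrices σ_i, τ_i (i ∈ I) with ρ = ∑_{i∈I} σ_i ⊗ τ_i (Kronecker product). For a POVM N = (N_a)_{a∈A} on ℂ² (A finite, each N_a positive semidefinite, ∑_a N_a = 1), define for each a the 2×2 matrix ρ̃_a by ρ̃_a(k,l) := ∑_{i ∈ Fin 2} ((N_a ⊗ 1) · ρ)((i,k),(i,l)) (the partial trace over the first factor of (N_a ⊗ 1)ρ), and let p(a) := Tr(ρ̃_a), a nonnegative real. Then ρ is NOT separable if and only if there exists a POVM (N_a)_{a∈A} on ℂ² with p(a) > 0 for all a ∈ A such that the set of states (p(a)⁻¹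 • ρ̃_a)_{a∈A} on ℂ² is nonclassical. -/
open Matrix BigOperators Kronecker
open scoped ComplexOrder

noncomputable section

/-- A two-qubit state is separable if it is a finite sum of Kronecker products of positive
semidefinite matrices. -/
def Separable (ρ : Matrix (Fin 2 × Fin 2) (Fin 2 × Fin 2) ℂ) : Prop :=
  ∃ (n : ℕ) (σ τ : Fin n → Matrix (Fin 2) (Fin 2) ℂ),
    (∀ i, (σ i).PosSemidef) ∧ (∀ i, (τ i).PosSemidef) ∧
    ρ = ∑ i, σ i ⊗ₖ τ i

/-- The subnormalized steered state obtained by measuring the effect `N` on the first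
factor: the partial trace over the first factor of `(N ⊗ 1) ρ`. -/
def steeredState (ρ : Matrix (Fin 2 × Fin 2) (Fin 2 × Fin 2) ℂ)
    (N : Matrix (Fin 2) (Fin 2) ℂ) : Matrix (Fin 2) (Fin 2) ℂ :=
  Matrix.of fun k l => ∑ i : Fin 2, ((N ⊗ₖ (1 : Matrix (Fin 2) (Fin 2) ℂ)) * ρ) (i, k) (i, l)


/-- The forward Lorentz cone. -/
def LC (x : Fin 4 → ℝ) : Prop := 0 ≤ x 0 ∧ x 1 ^ 2 + x 2 ^ 2 + x 3 ^ 2 ≤ x 0 ^ 2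

theorem LC_dot {x y : Fin 4 → ℝ} (hx : LC x) (hy : LC y) : 0 ≤ x ⬝ᵥ y := by
  obtain ⟨hx0, hx⟩ := hx
  obtain ⟨hy0, hy⟩ := hy
  simp only [dotProduct, Fin.sum_univ_four]
  have h1 : (x 1 * y 1 + x 2 * y 2 + x 3 * y 3) ^ 2 ≤ (x 0 * y 0) ^ 2 := by
    have : (x 1 * y 1 + x 2 * y 2 + x 3 * y 3) ^ 2 ≤
        (x 1 ^ 2 + x 2 ^ 2 + x 3 ^ 2) * (y 1 ^ 2 + y 2 ^ 2 + y 3 ^ 2) := by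
      nlinarith [sq_nonneg (x 1 * y 2 - x 2 * y 1), sq_nonneg (x 1 * y 3 - x 3 * y 1),
        sq_nonneg (x 2 * y 3 - x 3 * y 2)]
    calc _ ≤ _ := this
      _ ≤ x 0 ^ 2 * y 0 ^ 2 := by gcongr
      _ = _ := by ring
  have h2 := abs_le_of_sq_le_sq' h1 (by positivity)
  linarith [h2.1]

theorem LC_zero : LC 0 := by simp [LC]

theorem LC_smul {c : ℝ} (hc : 0 ≤ c) {x : Fin 4 → ℝ} (hx : LC x) : LC (c • x) := by
  refine ⟨mul_nonneg hc hx.1, ?_⟩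
  simp only [Pi.smul_apply, smul_eq_mul]
  nlinarith [mul_le_mul_of_nonneg_left hx.2 (sq_nonneg c)]

theorem LC_add {x y : Fin 4 → ℝ} (hx : LC x) (hy : LC y) : LC (x + y) := by
  refine ⟨add_nonneg hx.1 hy.1, ?_⟩
  have hy' : LC ![y 0, - y 1, - y 2, - y 3] := by
    have := hy.2
    exact ⟨by simpa using hy.1, by simpa using hy.2⟩
  have h := LC_dot hx hy'
  simp [dotProduct, Fin.sum_univ_four] at h
  simp only [Pi.add_apply]
  nlinarith [hx.2, hy.2]

theorem LC_sum {ι : Type*} (s : Finset ι) (f : ι → Fin 4 → ℝ) (h : ∀ i ∈ s, LC (f i)) :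
    LC (∑ i ∈ s, f i) := by
  classical
  induction s using Finset.induction_on with
  | empty => simpa using LC_zero
  | insert a s ha ih =>
    rw [Finset.sum_insert ha]
    exact LC_add (h a (by simp)) (ih fun i hi => h i (by simp [hi]))

theorem LC_eq_zero {x : Fin 4 → ℝ} (hx : LC x) (h : x 0 = 0) : x = 0 := by
  have h2 := hx.2
  rw [h] at h2
  ext i
  fin_cases i
  · exact h
  all_goals
    simp only [Fin.reduceFinMk, Pi.zero_apply, Fin.mk_one]
    nlinarith [sq_nonneg (x 1), sq_nonneg (x 2), sq_nonneg (x 3)]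

/-- Lorentz form. -/
def eta : LinearMap.BilinForm ℝ (Fin 4 → ℝ) :=
  LinearMap.mk₂ ℝ (fun x y => x 0 * y 0 - x 1 * y 1 - x 2 * y 2 - x 3 * y 3)
    (by intros; simp; ring) (by intros; simp; ring) (by intros; simp; ring) (by intros; simp; ring)

theorem eta_apply (x y : Fin 4 → ℝ) :
    eta x y = x 0 * y 0 - x 1 * y 1 - x 2 * y 2 - x 3 * y 3 := rfl

theorem eta_nonneg {x y : Fin 4 → ℝ} (hx : LC x) (hy : LC y) : 0 ≤ eta x y := by
  have hy' : LC ![y 0, - y 1, - y 2, - y 3] := by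
    have := hy.2
    exact ⟨by simpa using hy.1, by simpa using hy.2⟩
  have h := LC_dot hx hy'
  simp [dotProduct, Fin.sum_univ_four] at h
  rw [eta_apply]; linarith

theorem cs3 (x y : Fin 4 → ℝ) : (x 1 * y 1 + x 2 * y 2 + x 3 * y 3) ^ 2 ≤
        (x 1 ^ 2 + x 2 ^ 2 + x 3 ^ 2) * (y 1 ^ 2 + y 2 ^ 2 + y 3 ^ 2) := by
  nlinarith [sq_nonneg (x 1 * y 2 - x 2 * y 1), sq_nonneg (x 1 * y 3 - x 3 * y 1),
        sq_nonneg (x 2 * y 3 - x 3 * y 2)]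

theorem orth_neg {R t : Fin 4 → ℝ} (hR0 : 0 < R 0) (hR : R 1 ^ 2 + R 2 ^ 2 + R 3 ^ 2 < R 0 ^ 2)
    (h : eta R t = 0) : eta t t < 0 ∨ t = 0 := by
  rw [eta_apply] at h
  have e : R 0 * t 0 = R 1 * t 1 + R 2 * t 2 + R 3 * t 3 := by linarith
  have c := cs3 R t
  rw [← e] at c
  by_cases ht : t 1 ^ 2 + t 2 ^ 2 + t 3 ^ 2 = 0
  · right
    have h1 : t 1 = 0 := by nlinarith [sq_nonneg (t 1), sq_nonneg (t 2), sq_nonneg (t 3)]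
    have h2 : t 2 = 0 := by nlinarith [sq_nonneg (t 1), sq_nonneg (t 2), sq_nonneg (t 3)]
    have h3 : t 3 = 0 := by nlinarith [sq_nonneg (t 1), sq_nonneg (t 2), sq_nonneg (t 3)]
    rw [h1, h2, h3] at e
    have h0 : t 0 = 0 := by
      have : R 0 * t 0 = 0 := by linarith
      rcases mul_eq_zero.1 this with h | h
      · linarith
      · exact h
    ext i
    fin_cases i <;> simp [*]
  · left
    have hp : 0 < t 1 ^ 2 + t 2 ^ 2 + t 3 ^ 2 := lt_of_le_of_ne (by positivity) (Ne.symm ht)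
    have h4 : R 0 ^ 2 * t 0 ^ 2 < R 0 ^ 2 * (t 1 ^ 2 + t 2 ^ 2 + t 3 ^ 2) := by
      have := mul_lt_mul_of_pos_right hR hp
      nlinarith
    have := lt_of_mul_lt_mul_left h4 (by positivity)
    rw [eta_apply]; nlinarith

theorem fwd {R s : Fin 4 → ℝ} (hR0 : 0 < R 0) (hR : R 1 ^ 2 + R 2 ^ 2 + R 3 ^ 2 < R 0 ^ 2)
    (hs : 0 ≤ eta s s) (h : 0 ≤ eta R s) : LC s := by
  rw [eta_apply] at h hs
  refine ⟨?_, by nlinarith⟩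
  by_contra hn
  push Not at hn
  have c := cs3 R s
  have h1 : R 0 * s 0 < 0 := mul_neg_of_pos_of_neg hR0 hn
  have h2 : (R 0 * s 0) ^ 2 ≤ (R 1 * s 1 + R 2 * s 2 + R 3 * s 3) ^ 2 := by nlinarith
  have h3 : (R 1 ^ 2 + R 2 ^ 2 + R 3 ^ 2) * (s 1 ^ 2 + s 2 ^ 2 + s 3 ^ 2) ≤
    (R 1 ^ 2 + R 2 ^ 2 + R 3 ^ 2) * s 0 ^ 2 := by
    apply mul_le_mul_of_nonneg_left (by nlinarith) (by positivity)
  have h4 : (R 1 ^ 2 + R 2 ^ 2 + R 3 ^ 2) * s 0 ^ 2 < R 0 ^ 2 * s 0 ^ 2 :=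
    mul_lt_mul_of_pos_right hR (by have := hn.ne; positivity)
  nlinarith

theorem eta_refl : eta.IsRefl := by
  intro x y h
  rw [eta_apply] at *; linarith

theorem exists_proj (S : Submodule ℝ (Fin 4 → ℝ)) {R : Fin 4 → ℝ} (hRS : R ∈ S)
    (hR0 : 0 < R 0) (hR : R 1 ^ 2 + R 2 ^ 2 + R 3 ^ 2 < R 0 ^ 2) :
    ∃ P : (Fin 4 → ℝ) →ₗ[ℝ] (Fin 4 → ℝ), (∀ x, P x ∈ S) ∧ (∀ x ∈ S, P x = x) ∧
      ∀ x, LC x → LC (P x) := by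
  have key : ∀ s ∈ S, (∀ s' ∈ S, eta s' s = 0) → s = 0 := by
    intro s hs h
    rcases orth_neg hR0 hR (h R hRS) with h1 | h1
    · rw [h s hs] at h1; exact absurd h1 (lt_irrefl _)
    · exact h1
  have hc : IsCompl S (eta.orthogonal S) := by
    apply LinearMap.BilinForm.isCompl_orthogonal_of_restrict_nondegenerate eta_refl
    constructor
    · intro s hs
      apply Subtype.ext
      exact key s s.2 (fun s' hs' => eta_refl _ _ (hs ⟨s', hs'⟩))
    · intro s hs
      apply Subtype.ext
      exact key s s.2 (fun s' hs' => (hs ⟨s', hs'⟩))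
  refine ⟨S.projection _ hc, fun x => Submodule.projection_apply_mem hc x,
    fun x hx => Submodule.projection_apply_left hc ⟨x, hx⟩, fun x hx => ?_⟩
  set s := S.projection _ hc x with hs
  have hsS : s ∈ S := Submodule.projection_apply_mem hc x
  have ht : x - s ∈ eta.orthogonal S := Submodule.sub_projection_mem hc x
  have ht' : ∀ y ∈ S, eta y (x - s) = 0 := fun y hy => ht y hy
  have e1 := ht' R hRS
  have e2 := ht' s hsS
  have e3 : eta (x - s) (x - s) ≤ 0 := by
    rcases orth_neg hR0 hR e1 with h | h
    · exact h.le
    · rw [h]; simp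
  have hRC : LC R := ⟨hR0.le, hR.le⟩
  have e4 := eta_nonneg hRC hx
  have e5 := eta_nonneg hx hx
  refine fwd hR0 hR ?_ ?_
  · simp only [eta_apply, Pi.sub_apply] at *
    nlinarith
  · simp only [map_sub] at e1
    linarith

theorem light {R u : Fin 4 → ℝ} (hR0 : 0 < R 0) (hR : R 1 ^ 2 + R 2 ^ 2 + R 3 ^ 2 = R 0 ^ 2)
    (hu : LC u) (h : eta R u = 0) : u = (u 0 / R 0) • R := by
  rw [eta_apply] at h
  have h2 := hu.2
  have : (R 0 * u 1 - u 0 * R 1) ^ 2 + (R 0 * u 2 - u 0 * R 2) ^ 2 +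
      (R 0 * u 3 - u 0 * R 3) ^ 2 ≤ 0 := by
    have e : (R 0 * u 1 - u 0 * R 1) ^ 2 + (R 0 * u 2 - u 0 * R 2) ^ 2 +
      (R 0 * u 3 - u 0 * R 3) ^ 2 = R 0 ^ 2 * (u 1 ^ 2 + u 2 ^ 2 + u 3 ^ 2)
        - 2 * R 0 * u 0 * (R 1 * u 1 + R 2 * u 2 + R 3 * u 3)
        + u 0 ^ 2 * (R 1 ^ 2 + R 2 ^ 2 + R 3 ^ 2) := by ring
    rw [e, hR, show R 1 * u 1 + R 2 * u 2 + R 3 * u 3 = R 0 * u 0 by linarith]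
    nlinarith [mul_le_mul_of_nonneg_left h2 (sq_nonneg (R 0))]
  have a1 : R 0 * u 1 - u 0 * R 1 = 0 := by
    apply pow_eq_zero_iff (two_ne_zero) |>.1; nlinarith [sq_nonneg (R 0 * u 1 - u 0 * R 1), sq_nonneg (R 0 * u 2 - u 0 * R 2), sq_nonneg (R 0 * u 3 - u 0 * R 3)]
  have a2 : R 0 * u 2 - u 0 * R 2 = 0 := by
    apply pow_eq_zero_iff (two_ne_zero) |>.1; nlinarith [sq_nonneg (R 0 * u 1 - u 0 * R 1), sq_nonneg (R 0 * u 2 - u 0 * R 2), sq_nonneg (R 0 * u 3 - u 0 * R 3)]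
  have a3 : R 0 * u 3 - u 0 * R 3 = 0 := by
    apply pow_eq_zero_iff (two_ne_zero) |>.1; nlinarith [sq_nonneg (R 0 * u 1 - u 0 * R 1), sq_nonneg (R 0 * u 2 - u 0 * R 2), sq_nonneg (R 0 * u 3 - u 0 * R 3)]
  have hne := hR0.ne'
  ext i
  fin_cases i <;> simp <;> field_simp <;> linarith

/-- Refined decomposition with first factors in the range. -/
theorem refine_decomp {n : ℕ} (T : Matrix (Fin 4) (Fin 4) ℝ) (u v : Fin n → Fin 4 → ℝ)
    (hu : ∀ i, LC (u i)) (hv : ∀ i, LC (v i)) (hT : T = ∑ i, vecMulVec (u i) (v i))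
    (h00 : 0 < T 0 0) :
    ∃ y : Fin n → Fin 4 → ℝ, (∀ i, LC (T *ᵥ y i)) ∧ T = ∑ i, vecMulVec (T *ᵥ y i) (v i) := by
  have hTm : ∀ z, T *ᵥ z = ∑ i, (v i ⬝ᵥ z) • u i := by
    intro z
    rw [hT, Matrix.sum_mulVec]
    refine Finset.sum_congr rfl fun i _ => ?_
    rw [vecMulVec_mulVec]; ext; simp [mul_comm]
  suffices h : ∃ w : Fin n → Fin 4 → ℝ, (∀ i, LC (w i)) ∧
      (∀ i, w i ∈ LinearMap.range T.mulVecLin) ∧ T = ∑ i, vecMulVec (w i) (v i) by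
    obtain ⟨w, h1, h2, h3⟩ := h
    choose y hy using h2
    have hy' : ∀ i, T *ᵥ y i = w i := hy
    exact ⟨y, by simpa [hy'] using h1, by simpa [hy'] using h3⟩
  set R := T *ᵥ Pi.single 0 1 with hRdef
  have hR0 : 0 < R 0 := by simpa [hRdef] using h00
  have hRsum : R = ∑ i, v i 0 • u i := by
    rw [hRdef, hTm]; simp
  have hRC : LC R := by
    rw [hRsum]; exact LC_sum _ _ fun i _ => LC_smul (hv i).1 (hu i)
  have hRS : R ∈ LinearMap.range T.mulVecLin := ⟨_, rfl⟩
  rcases hRC.2.lt_or_eq with hlt | heq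
  · obtain ⟨P, hP1, hP2, hP3⟩ := exists_proj _ hRS hR0 hlt
    refine ⟨fun i => P (u i), fun i => hP3 _ (hu i), fun i => hP1 _, ?_⟩
    apply Matrix.ext_of_mulVec_single
    intro j
    have : T *ᵥ Pi.single j 1 = P (T *ᵥ Pi.single j 1) := (hP2 _ ⟨_, rfl⟩).symm
    rw [this, hTm, map_sum, Matrix.sum_mulVec]
    refine Finset.sum_congr rfl fun i _ => ?_
    rw [vecMulVec_mulVec, map_smul]; ext; simp [mul_comm]
  · refine ⟨fun i => if v i 0 = 0 then 0 else u i, ?_, ?_, ?_⟩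
    · intro i
      dsimp only
      split_ifs
      · exact LC_zero
      · exact hu i
    · intro i
      dsimp only
      split_ifs with h
      · exact Submodule.zero_mem _
      · have e0 : eta R R = 0 := by rw [eta_apply]; linarith
        have e1 : ∑ i, v i 0 * eta R (u i) = 0 := by
          rw [← e0]
          conv_rhs => rw [hRsum, map_sum]
          rw [← hRsum]; simp
        have e2 := (Finset.sum_eq_zero_iff_of_nonneg
          (fun i _ => mul_nonneg (hv i).1 (eta_nonneg hRC (hu i)))).1 e1 i (Finset.mem_univ _)
        have e3 := (mul_eq_zero.1 e2).resolve_left h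
        rw [light hR0 heq (hu i) e3]
        exact Submodule.smul_mem _ _ hRS
    · conv_lhs => rw [hT]
      refine Finset.sum_congr rfl fun i _ => ?_
      dsimp only
      split_ifs with h
      · rw [LC_eq_zero (hv i) h]; simp
      · rfl

/-- Pauli matrices. -/
def Pa : Fin 4 → Matrix (Fin 2) (Fin 2) ℂ :=
  ![1, !![0, 1; 1, 0], !![0, -Complex.I; Complex.I, 0], !![1, 0; 0, -1]]

/-- Bloch parametrization. -/
def HM : (Fin 4 → ℝ) →ₗ[ℝ] Matrix (Fin 2) (Fin 2) ℂ where
  toFun x := ∑ i, x i • Pa i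
  map_add' x y := by simp [add_smul, Finset.sum_add_distrib]
  map_smul' c x := by simp [Finset.smul_sum, smul_smul]

theorem HM_apply (x : Fin 4 → ℝ) : HM x = ∑ i, x i • Pa i := rfl

theorem HM_eq (x : Fin 4 → ℝ) : HM x =
    !![(x 0 : ℂ) + x 3, x 1 - x 2 * Complex.I; x 1 + x 2 * Complex.I, x 0 - x 3] := by
  rw [HM_apply, Fin.sum_univ_four]
  ext i j
  fin_cases i <;> fin_cases j <;> simp [Pa] <;> ring

theorem HM_trace (x : Fin 4 → ℝ) : (HM x).trace = ((2 * x 0 : ℝ) : ℂ) := by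
  rw [HM_eq]; simp [Matrix.trace, Fin.sum_univ_two]; ring

theorem HM_inj {x y : Fin 4 → ℝ} (h : HM x = HM y) : x = y := by
  rw [HM_eq, HM_eq] at h
  have h00 := congrArg Complex.re (congrFun (congrFun h 0) 0)
  have h11 := congrArg Complex.re (congrFun (congrFun h 1) 1)
  have h10 := congrArg Complex.re (congrFun (congrFun h 1) 0)
  have h10' := congrArg Complex.im (congrFun (congrFun h 1) 0)
  simp at h00 h11 h10 h10'
  ext i
  fin_cases i <;> simp <;> linarith

theorem HM_herm (x : Fin 4 → ℝ) : (HM x).IsHermitian := by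
  rw [HM_eq]
  ext i j
  fin_cases i <;> fin_cases j <;> simp [Matrix.conjTranspose_apply] <;> ring

theorem exists_HM {A : Matrix (Fin 2) (Fin 2) ℂ} (hA : A.IsHermitian) : ∃ x, A = HM x := by
  refine ⟨![((A 0 0).re + (A 1 1).re) / 2, (A 1 0).re, (A 1 0).im, ((A 0 0).re - (A 1 1).re) / 2], ?_⟩
  rw [HM_eq]
  have h00 := congrArg Complex.im (hA.apply 0 0)
  have h11 := congrArg Complex.im (hA.apply 1 1)
  have h01 := hA.apply 0 1
  simp at h00 h11
  ext i j
  fin_cases i <;> fin_cases j <;> simp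
  · apply Complex.ext
    · simp; ring
    · simp; linarith
  · rw [← h01]
    apply Complex.ext <;> simp
  · apply Complex.ext
    · simp; ring
    · simp; linarith

theorem HM_psd {x : Fin 4 → ℝ} : (HM x).PosSemidef ↔ LC x := by
  constructor
  · intro h
    have htr := h.trace_nonneg
    have hdet := h.det_nonneg
    rw [HM_trace] at htr
    have hd : (HM x).det = ((x 0 ^ 2 - (x 1 ^ 2 + x 2 ^ 2 + x 3 ^ 2) : ℝ) : ℂ) := by
      rw [HM_eq, Matrix.det_fin_two_of]
      push_cast
      linear_combination (x 2 : ℂ) ^ 2 * Complex.I_sq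
    rw [hd] at hdet
    have h1 : 0 ≤ 2 * x 0 := by exact_mod_cast htr
    have h2 : 0 ≤ x 0 ^ 2 - (x 1 ^ 2 + x 2 ^ 2 + x 3 ^ 2) := by exact_mod_cast hdet
    exact ⟨by linarith, by linarith⟩
  · intro h
    rw [posSemidef_iff_dotProduct_mulVec]
    refine ⟨HM_herm x, fun z => ?_⟩
    set w : Fin 4 → ℝ := ![Complex.normSq (z 0) + Complex.normSq (z 1),
      2 * ((z 0).re * (z 1).re + (z 0).im * (z 1).im),
      2 * ((z 0).re * (z 1).im - (z 0).im * (z 1).re),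
      Complex.normSq (z 0) - Complex.normSq (z 1)] with hw
    have hwC : LC w := by
      refine ⟨?_, le_of_eq ?_⟩
      · simp only [hw, Matrix.cons_val_zero]
        exact add_nonneg (Complex.normSq_nonneg _) (Complex.normSq_nonneg _)
      · simp [hw, Complex.normSq_apply]; ring
    have hp := LC_dot h hwC
    have e : star z ⬝ᵥ HM x *ᵥ z = ((x ⬝ᵥ w : ℝ) : ℂ) := by
      rw [HM_eq]
      simp only [dotProduct, Fin.sum_univ_two, Fin.sum_univ_four, Matrix.mulVec, hw]
      apply Complex.ext
      · simp [Complex.normSq_apply]; ring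
      · simp; ring
    rw [e]
    exact_mod_cast hp

/-- Correlation parametrization. -/
def KM : Matrix (Fin 4) (Fin 4) ℝ →ₗ[ℝ] Matrix (Fin 2 × Fin 2) (Fin 2 × Fin 2) ℂ where
  toFun T := ∑ i, ∑ j, T i j • (Pa i ⊗ₖ Pa j)
  map_add' x y := by simp [add_smul, Finset.sum_add_distrib]
  map_smul' c x := by simp [Finset.smul_sum, smul_smul]

theorem KM_apply (T : Matrix (Fin 4) (Fin 4) ℝ) : KM T = ∑ i, ∑ j, T i j • (Pa i ⊗ₖ Pa j) := rfl

theorem KM_vec (u v : Fin 4 → ℝ) : KM (vecMulVec u v) = HM u ⊗ₖ HM v := by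
  rw [KM_apply, HM_apply, HM_apply]
  ext ⟨i, k⟩ ⟨j, l⟩
  simp only [Matrix.sum_apply, Matrix.kroneckerMap_apply, Matrix.smul_apply, vecMulVec_apply,
    Finset.sum_mul_sum, smul_mul_smul_comm]

theorem trace_HM_Pa (n : Fin 4 → ℝ) (i : Fin 4) : (HM n * Pa i).trace = ((2 * n i : ℝ) : ℂ) := by
  rw [HM_eq]
  fin_cases i <;> simp [Matrix.trace, Fin.sum_univ_two, Pa, Matrix.mul_apply, Matrix.one_apply]
  · ring
  · ring
  · linear_combination (-2 * n 2 : ℂ) * Complex.I_sq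
  · ring

theorem steered_kron (A B N : Matrix (Fin 2) (Fin 2) ℂ) :
    steeredState (A ⊗ₖ B) N = (N * A).trace • B := by
  ext k l
  simp only [steeredState, Matrix.of_apply, ← Matrix.mul_kronecker_mul, Matrix.one_mul,
    Matrix.kroneckerMap_apply, Matrix.smul_apply, Matrix.trace, Matrix.diag_apply,
    Finset.sum_mul, smul_eq_mul]

theorem steered_add (A B : Matrix (Fin 2 × Fin 2) (Fin 2 × Fin 2) ℂ)
    (N : Matrix (Fin 2) (Fin 2) ℂ) :
    steeredState (A + B) N = steeredState A N + steeredState B N := by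
  ext k l
  simp [steeredState, Matrix.mul_add, Finset.sum_add_distrib]

theorem steered_smul (c : ℝ) (A : Matrix (Fin 2 × Fin 2) (Fin 2 × Fin 2) ℂ)
    (N : Matrix (Fin 2) (Fin 2) ℂ) :
    steeredState (c • A) N = c • steeredState A N := by
  ext k l
  simp [steeredState]

/-- steering as a linear map -/
def stL (N : Matrix (Fin 2) (Fin 2) ℂ) :
    Matrix (Fin 2 × Fin 2) (Fin 2 × Fin 2) ℂ →ₗ[ℝ] Matrix (Fin 2) (Fin 2) ℂ where
  toFun A := steeredState A N
  map_add' A B := steered_add A B N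
  map_smul' c A := steered_smul c A N

theorem steered_KM (T : Matrix (Fin 4) (Fin 4) ℝ) (n : Fin 4 → ℝ) :
    steeredState (KM T) (HM n) = (2 : ℝ) • HM (n ᵥ* T) := by
  change stL (HM n) (KM T) = _
  rw [KM_apply, map_sum, HM_apply (n ᵥ* T), Finset.smul_sum, Finset.sum_congr rfl (fun i _ => map_sum _ _ _),
    Finset.sum_comm]
  refine Finset.sum_congr rfl fun j _ => ?_
  simp only [Matrix.vecMul, dotProduct, Finset.sum_smul, Finset.smul_sum]
  refine Finset.sum_congr rfl fun i _ => ?_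
  rw [map_smul]
  change _ • steeredState _ _ = _
  rw [steered_kron, trace_HM_Pa]
  ext k l
  simp
  ring

theorem KM_rows (T : Matrix (Fin 4) (Fin 4) ℝ) : KM T = ∑ i, Pa i ⊗ₖ HM (T i) := by
  rw [KM_apply]
  refine Finset.sum_congr rfl fun i _ => ?_
  rw [HM_apply]
  ext ⟨a, k⟩ ⟨b, l⟩
  simp only [Matrix.sum_apply, Matrix.kroneckerMap_apply, Matrix.smul_apply, Finset.mul_sum,
    mul_smul_comm]

theorem KM_trace (T : Matrix (Fin 4) (Fin 4) ℝ) : (KM T).trace = ((4 * T 0 0 : ℝ) : ℂ) := by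
  rw [KM_rows, Matrix.trace_sum]
  simp only [Matrix.trace_kronecker, HM_trace, Fin.sum_univ_four]
  have h0 : (Pa 0).trace = 2 := by simp [Pa]
  have h1 : (Pa 1).trace = 0 := by simp [Pa, Matrix.trace, Fin.sum_univ_two]
  have h2 : (Pa 2).trace = 0 := by simp [Pa, Matrix.trace, Fin.sum_univ_two]
  have h3 : (Pa 3).trace = 0 := by simp [Pa, Matrix.trace, Fin.sum_univ_two]
  rw [h0, h1, h2, h3]
  push_cast
  ring

theorem exists_KM {ρ : Matrix (Fin 2 × Fin 2) (Fin 2 × Fin 2) ℂ} (h : ρ.IsHermitian) :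
    ∃ T, ρ = KM T := by
  have ha : ∀ i j, star (ρ j i) = ρ i j := fun i j => h.apply i j
  obtain ⟨p0, h0⟩ := exists_HM (A := Matrix.of fun k l => (ρ (0, k) (0, l) + ρ (1, k) (1, l)) / 2)
    (by ext k l; simp only [Matrix.conjTranspose_apply, Matrix.of_apply, star_div₀, star_add, ha]
        simp)
  obtain ⟨p1, h1⟩ := exists_HM (A := Matrix.of fun k l => (ρ (0, k) (1, l) + ρ (1, k) (0, l)) / 2)
    (by ext k l; simp only [Matrix.conjTranspose_apply, Matrix.of_apply, star_div₀, star_add, ha]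
        simp [add_comm])
  obtain ⟨p2, h2⟩ := exists_HM
    (A := Matrix.of fun k l => Complex.I * (ρ (0, k) (1, l) - ρ (1, k) (0, l)) / 2)
    (by ext k l; simp only [Matrix.conjTranspose_apply, Matrix.of_apply, star_div₀, star_sub,
          star_mul, ha]
        simp; ring)
  obtain ⟨p3, h3⟩ := exists_HM (A := Matrix.of fun k l => (ρ (0, k) (0, l) - ρ (1, k) (1, l)) / 2)
    (by ext k l; simp only [Matrix.conjTranspose_apply, Matrix.of_apply, star_div₀, star_sub, ha]
        simp)
  refine ⟨Matrix.of ![p0, p1, p2, p3], ?_⟩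
  have e : ∀ i, (Matrix.of ![p0, p1, p2, p3]) i = ![p0, p1, p2, p3] i := fun i => rfl
  rw [KM_rows, Fin.sum_univ_four, e, e, e, e]
  change ρ = Pa 0 ⊗ₖ HM p0 + Pa 1 ⊗ₖ HM p1 + Pa 2 ⊗ₖ HM p2 + Pa 3 ⊗ₖ HM p3
  rw [← h0, ← h1, ← h2, ← h3]
  ext ⟨i, k⟩ ⟨j, l⟩
  simp only [Matrix.add_apply, Matrix.kroneckerMap_apply, Matrix.of_apply]
  fin_cases i <;> fin_cases j <;> simp [Pa]
  · ring
  · linear_combination ((ρ (0, k) (1, l) - ρ (1, k) (0, l)) / 2) * Complex.I_sq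
  · linear_combination -((ρ (0, k) (1, l) - ρ (1, k) (0, l)) / 2) * Complex.I_sq
  · ring

theorem HM_e0 : HM (Pi.single 0 1) = 1 := by
  rw [HM_eq]
  ext i j
  fin_cases i <;> fin_cases j <;> simp

theorem KM_inj {T T' : Matrix (Fin 4) (Fin 4) ℝ} (h : KM T = KM T') : T = T' := by
  apply Matrix.ext_of_single_vecMul
  intro i
  have h1 := steered_KM T (Pi.single i 1)
  rw [h, steered_KM] at h1
  exact (HM_inj (smul_right_injective _ (two_ne_zero' ℝ) h1)).symm

/-- States form. -/
def stF (T : Matrix (Fin 4) (Fin 4) ℝ) {m : ℕ} (N : Fin m → Fin 4 → ℝ) :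
    Fin m → Matrix (Fin 2) (Fin 2) ℂ :=
  fun a => (2 * (N a ᵥ* T) 0)⁻¹ • HM (N a ᵥ* T)

theorem steered_form (T : Matrix (Fin 4) (Fin 4) ℝ) (n : Fin 4 → ℝ) :
    (steeredState (KM T) (HM n)).trace.re = 4 * (n ᵥ* T) 0 := by
  rw [steered_KM, Matrix.trace_smul, HM_trace]
  simp; ring

theorem states_form (T : Matrix (Fin 4) (Fin 4) ℝ) {m : ℕ} (N : Fin m → Fin 4 → ℝ) :
    (fun a : Fin m => ((steeredState (KM T) (HM (N a))).trace.re)⁻¹ •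
      steeredState (KM T) (HM (N a))) = stF T N := by
  funext a
  rw [steered_form, steered_KM, smul_smul, stF]
  congr 1
  rw [mul_inv, mul_inv]; ring

theorem classical_of_sep (T : Matrix (Fin 4) (Fin 4) ℝ) (h00 : 0 < T 0 0) {n : ℕ}
    (u v : Fin n → Fin 4 → ℝ)
    (hu : ∀ i, LC (u i)) (hv : ∀ i, LC (v i)) (hT : T = ∑ i, vecMulVec (u i) (v i))
    {m : ℕ} (hm : 0 < m) (N : Fin m → Fin 4 → ℝ) (hN : ∀ a, LC (N a))
    (hp : ∀ a, 0 < (N a ᵥ* T) 0) : IsClassicalStates (stF T N) := by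
  obtain ⟨y, hy, hTy⟩ := refine_decomp T u v hu hv hT h00
  set g : (Fin 4 → ℝ) → Fin m → ℝ := fun z a => ((N a ᵥ* T) 0)⁻¹ * (N a ⬝ᵥ T *ᵥ z) with hg
  have hgz : ∀ z, ∀ α : Fin m → ℝ, (∑ a, α a • stF T N a = 0) → ∑ a, α a * g z a = 0 := by
    intro z α h
    have h1 : HM ((∑ a, (α a * (2 * (N a ᵥ* T) 0)⁻¹) • N a) ᵥ* T) = HM 0 := by
      rw [Matrix.sum_vecMul, map_sum, map_zero, ← h]
      refine Finset.sum_congr rfl fun a _ => ?_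
      rw [Matrix.smul_vecMul, map_smul, stF, smul_smul]
    have h2 := HM_inj h1
    have h3 : (∑ a, (α a * (2 * (N a ᵥ* T) 0)⁻¹) • N a) ⬝ᵥ T *ᵥ z = 0 := by
      rw [Matrix.dotProduct_mulVec, h2, zero_dotProduct]
    rw [sum_dotProduct] at h3
    have h4 : ∑ a, α a * g z a = 2 * ∑ a, ((α a * (2 * (N a ᵥ* T) 0)⁻¹) • N a) ⬝ᵥ T *ᵥ z := by
      rw [Finset.mul_sum]
      refine Finset.sum_congr rfl fun a _ => ?_
      rw [smul_dotProduct, hg, smul_eq_mul, mul_inv]; ring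
    rw [h4, h3, mul_zero]
  have hgn : ∀ i a, 0 ≤ g (y i) a := fun i a =>
    mul_nonneg (inv_nonneg.2 (hp a).le) (LC_dot (hN a) (hy i))
  have hg1 : ∀ a, g (Pi.single 0 1) a = 1 := by
    intro a
    simp only [hg]
    rw [Matrix.dotProduct_mulVec, dotProduct_single_one, inv_mul_cancel₀ (hp a).ne']
  set c : Fin n → ℝ := fun i => ∑ a, g (y i) a with hc
  have hc0 : ∀ i, 0 ≤ c i := fun i => Finset.sum_nonneg fun a _ => hgn i a
  have hmR : (0 : ℝ) < m := by exact_mod_cast hm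
  refine ⟨n, fun i => (c i / 2) • HM (v i),
    fun i => if c i = 0 then fun _ => (m : ℝ)⁻¹ else fun a => (c i)⁻¹ * g (y i) a, ?_, ?_, ?_⟩
  · intro i
    change ((c i / 2) • HM (v i)).PosSemidef
    rw [← map_smul]
    exact HM_psd.2 (LC_smul (by have := hc0 i; positivity) (hv i))
  · intro i
    dsimp only
    split_ifs with h
    · refine ⟨fun a => by positivity, ?_, fun α hα => ?_⟩
      · simp [hmR.ne']
      · have := hgz (Pi.single 0 1) α hα
        simp only [hg1, mul_one] at this
        rw [← Finset.sum_mul, this, zero_mul]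
    · refine ⟨fun a => mul_nonneg (inv_nonneg.2 (hc0 i)) (hgn i a), ?_, fun α hα => ?_⟩
      · rw [← Finset.mul_sum]; exact inv_mul_cancel₀ h
      · have := hgz (y i) α hα
        calc _ = (c i)⁻¹ * ∑ a, α a * g (y i) a := by
              rw [Finset.mul_sum]
              exact Finset.sum_congr rfl fun a _ => by ring
          _ = 0 := by rw [this, mul_zero]
  · intro a
    have e : N a ᵥ* T = ∑ i, (N a ⬝ᵥ T *ᵥ y i) • v i := by
      conv_lhs => rw [hTy]
      rw [Matrix.vecMul_sum]
      refine Finset.sum_congr rfl fun i _ => ?_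
      rw [vecMul_vecMulVec]
    rw [stF]
    conv_lhs => rw [show HM (N a ᵥ* T) = HM (∑ i, (N a ⬝ᵥ T *ᵥ y i) • v i) from by rw [← e]]
    rw [map_sum, Finset.smul_sum]
    refine Finset.sum_congr rfl fun i _ => ?_
    rw [map_smul, smul_smul, smul_smul]
    congr 1
    dsimp only
    split_ifs with h
    · have h0 := (Finset.sum_eq_zero_iff_of_nonneg (fun a _ => hgn i a)).1 h a (Finset.mem_univ _)
      rw [h]
      simp only [hg] at h0
      rw [mul_inv, mul_assoc, h0]; simp
    · field_simp
      simp only [hg]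
      field_simp [(hp a).ne']

theorem net (ε : ℝ) (hε : 0 < ε) : ∃ (m : ℕ) (N : Fin m → Fin 4 → ℝ), (∀ a, LC (N a)) ∧
    (∑ a, N a = Pi.single 0 1) ∧ (∀ a x, LC x → 0 < x 0 → 0 < N a ⬝ᵥ x) ∧
    ∀ s : Fin 4 → ℝ, (∀ a, 0 ≤ N a ⬝ᵥ s) →
      0 ≤ s 0 ∧ s 1 ^ 2 + s 2 ^ 2 + s 3 ^ 2 ≤ ((1 + ε) * s 0) ^ 2 := by
  set δ : ℝ := ε / (2 * (1 + ε)) with hδ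
  have hδ0 : 0 < δ := by positivity
  have hδ1 : δ < 1 := by rw [hδ, div_lt_one (by positivity)]; linarith
  have hδ2 : 1 ≤ (1 + ε) * (1 - δ) ^ 2 := by
    have : (1 + ε) * (1 - 2 * δ) = 1 := by rw [hδ]; field_simp; ring
    nlinarith [mul_nonneg (by positivity : 0 ≤ 1 + ε) (sq_nonneg δ)]
  obtain ⟨t, hts, htf, htc⟩ := (isCompact_sphere (0 : EuclideanSpace ℝ (Fin 3)) 1).finite_cover_balls hδ0
  have hns : ∀ x : EuclideanSpace ℝ (Fin 3), ‖x‖ ^ 2 = x 0 ^ 2 + x 1 ^ 2 + x 2 ^ 2 := by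
    intro x; rw [EuclideanSpace.real_norm_sq_eq, Fin.sum_univ_three]
  have hin : ∀ x y : EuclideanSpace ℝ (Fin 3),
      inner ℝ x y = x 0 * y 0 + x 1 * y 1 + x 2 * y 2 := by
    intro x y; rw [PiLp.inner_apply, Fin.sum_univ_three]; simp; ring
  have hcov : ∀ x : EuclideanSpace ℝ (Fin 3), ‖x‖ = 1 → ∃ f ∈ t, ‖x - f‖ < δ := by
    intro x hx
    have := htc (show x ∈ Metric.sphere 0 1 by simpa using hx)
    simp only [Set.mem_iUnion, Metric.mem_ball, dist_eq_norm] at this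
    obtain ⟨f, hf, h⟩ := this
    exact ⟨f, hf, h⟩
  have hsp : ∀ f ∈ t, ‖f‖ = 1 := fun f hf => by simpa using hts hf
  obtain ⟨f0, hf0, -⟩ := hcov (EuclideanSpace.single 0 1) (by simp)
  haveI := htf.fintype
  set I := (t × Bool)
  have : Nonempty I := ⟨(⟨f0, hf0⟩, true)⟩
  set e := Fintype.equivFin I
  set M := Fintype.card I with hM
  have hM0 : (0 : ℝ) < M := by exact_mod_cast Fintype.card_pos
  set sg : Bool → ℝ := fun b => if b then (1 - δ) else -(1 - δ) with hsg
  set W : I → Fin 4 → ℝ := fun i => (M : ℝ)⁻¹ • ![1, sg i.2 * i.1.1 0, sg i.2 * i.1.1 1, sg i.2 * i.1.1 2]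
    with hW
  set vc : (Fin 4 → ℝ) → EuclideanSpace ℝ (Fin 3) := fun s => !₂[s 1, s 2, s 3] with hvc
  have hWd : ∀ i s, W i ⬝ᵥ s = (M : ℝ)⁻¹ * (s 0 + sg i.2 * inner ℝ i.1.1 (vc s)) := by
    intro i s
    rw [hin, hW, smul_dotProduct, smul_eq_mul]
    simp [dotProduct, Fin.sum_univ_four, hvc]
    left; ring
  have hvn : ∀ s, ‖vc s‖ ^ 2 = s 1 ^ 2 + s 2 ^ 2 + s 3 ^ 2 := by
    intro s; rw [hns]; simp [hvc]
  have hsga : ∀ b, |sg b| = 1 - δ := by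
    intro b
    have h : 0 < 1 - δ := by linarith
    cases b
    · simp only [hsg, Bool.false_eq_true, if_false]; rw [abs_neg, abs_of_pos h]
    · simp only [hsg]; simp [abs_of_pos h]
  have hpos : ∀ i x, LC x → 0 < x 0 → 0 < W i ⬝ᵥ x := by
    intro i x hx h0
    rw [hWd]
    apply mul_pos (by positivity)
    have h1 : |sg i.2 * inner ℝ i.1.1 (vc x)| ≤ (1 - δ) * ‖vc x‖ := by
      rw [abs_mul, hsga]
      apply mul_le_mul_of_nonneg_left _ (by linarith)
      have := abs_real_inner_le_norm i.1.1 (vc x)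
      rwa [hsp _ i.1.2, one_mul] at this
    have h2 : ‖vc x‖ ≤ x 0 := by
      apply abs_le_of_sq_le_sq' _ h0.le |>.2
      rw [hvn]; exact hx.2
    have h3 := (abs_le.1 h1).1
    have h4 : (1 - δ) * ‖vc x‖ ≤ (1 - δ) * x 0 := mul_le_mul_of_nonneg_left h2 (by linarith)
    nlinarith
  refine ⟨M, fun a => W (e.symm a), ?_, ?_, ?_, ?_⟩
  · intro a
    apply LC_smul (by positivity)
    refine ⟨by simp, ?_⟩
    have h1 := hns (e.symm a).1.1
    rw [hsp _ (e.symm a).1.2] at h1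
    have h2 : sg (e.symm a).2 ^ 2 ≤ 1 := by
      rw [← sq_abs, hsga]; nlinarith
    simp
    nlinarith
  · rw [e.symm.sum_comp W]
    rw [Fintype.sum_prod_type]
    simp only [Fintype.sum_bool]
    have : ∀ x : t, W (x, true) + W (x, false) = ((M : ℝ)⁻¹ * 2) • Pi.single 0 1 := by
      intro x
      ext j
      fin_cases j <;> simp [hW, hsg] <;> ring
    simp only [this]
    rw [Finset.sum_const, Finset.card_univ, ← Nat.cast_smul_eq_nsmul ℝ, smul_smul]
    have hMc : (M : ℝ) = Fintype.card t * 2 := by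
      rw [hM, Fintype.card_prod]; simp
    have : (Fintype.card t : ℝ) * ((M : ℝ)⁻¹ * 2) = 1 := by
      rw [mul_left_comm, ← hMc]; exact inv_mul_cancel₀ hM0.ne'
    rw [this, one_smul]
  · intro a x
    exact hpos _ x
  · intro s hs
    have hs' : ∀ i : I, 0 ≤ s 0 + sg i.2 * inner ℝ i.1.1 (vc s) := by
      intro i
      have := hs (e i)
      dsimp only at this
      rw [Equiv.symm_apply_apply, hWd] at this
      exact nonneg_of_mul_nonneg_right this (by positivity)
    have hb : (1 - δ) ^ 2 * ‖vc s‖ ≤ s 0 := by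
      by_cases hz : ‖vc s‖ = 0
      · have h1 := hs' (⟨f0, hf0⟩, true)
        have h2 := hs' (⟨f0, hf0⟩, false)
        simp [hsg] at h1 h2
        rw [hz]; linarith
      · have hzp : 0 < ‖vc s‖ := lt_of_le_of_ne (norm_nonneg _) (Ne.symm hz)
        obtain ⟨f, hf, hd⟩ := hcov (-(‖vc s‖⁻¹ • vc s)) (by
          rw [norm_neg, norm_smul, norm_inv, norm_norm, inv_mul_cancel₀ hz])
        have h1 := hs' (⟨f, hf⟩, true)
        simp only [hsg, if_true] at h1
        have h2 : inner ℝ (-(‖vc s‖⁻¹ • vc s)) (vc s) = -‖vc s‖ := by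
          rw [inner_neg_left, inner_smul_left, real_inner_self_eq_norm_sq]
          simp; field_simp
        have h3 : |inner ℝ (-(‖vc s‖⁻¹ • vc s) - f) (vc s)| ≤ δ * ‖vc s‖ :=
          (abs_real_inner_le_norm _ _).trans (mul_le_mul_of_nonneg_right hd.le hzp.le)
        rw [inner_sub_left, h2] at h3
        have h4 := (abs_le.1 h3).1
        have h5 : inner ℝ f (vc s) ≤ -((1 - δ) * ‖vc s‖) := by linarith
        have h6 := mul_le_mul_of_nonneg_left h5 (by linarith : 0 ≤ 1 - δ)
        nlinarith
    have h0 : 0 ≤ s 0 := le_trans (by positivity) hb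
    refine ⟨h0, ?_⟩
    rw [← hvn]
    apply pow_le_pow_left₀ (norm_nonneg _)
    calc ‖vc s‖ ≤ ((1 + ε) * (1 - δ) ^ 2) * ‖vc s‖ := le_mul_of_one_le_left (norm_nonneg _) hδ2
      _ = (1 + ε) * ((1 - δ) ^ 2 * ‖vc s‖) := by ring
      _ ≤ _ := by gcongr

abbrev M4 := Matrix (Fin 4) (Fin 4) ℝ

theorem carath {s : Set M4} (hs : s.Nonempty) {x : M4} (hx : x ∈ convexHull ℝ s) :
    ∃ w ∈ stdSimplex ℝ (Fin 17), ∃ z : Fin 17 → M4, (∀ i, z i ∈ s) ∧ ∑ i, w i • z i = x := by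
  classical
  obtain ⟨ι, _, z, w, hz, hai, hw, hw1, hx⟩ := eq_pos_convex_span_of_mem_convexHull hx
  obtain ⟨z0, hz0⟩ := hs
  have : Nonempty ι := by
    by_contra h
    rw [not_nonempty_iff] at h
    simp at hw1
  have hcard : Fintype.card ι ≤ 17 := by
    rw [← hai.finrank_vectorSpan_add_one]
    have h1 := Submodule.finrank_le (vectorSpan ℝ (Set.range z))
    have h2 : Module.finrank ℝ M4 = 16 := by
      rw [Module.finrank_matrix]; simp
    omega
  obtain ⟨f⟩ : Nonempty (ι ↪ Fin 17) :=
    Function.Embedding.nonempty_of_card_le (by simpa using hcard)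
  have hsum : ∀ {β : Type} [AddCommMonoid β] (g : ι → β),
      ∑ k, (Function.extend f g 0) k = ∑ i, g i := by
    intro β _ g
    rw [← Finset.sum_subset (Finset.subset_univ (Finset.univ.map f))]
    · rw [Finset.sum_map]
      exact Finset.sum_congr rfl fun i _ => f.injective.extend_apply _ _ _
    · intro k _ hk
      rw [Function.extend_apply']
      · rfl
      · rintro ⟨i, rfl⟩
        exact hk (by simp)
  refine ⟨Function.extend f w 0, ⟨?_, ?_⟩, Function.extend f z (fun _ => z0), ?_, ?_⟩
  · intro k
    by_cases hk : ∃ i, f i = k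
    · obtain ⟨i, rfl⟩ := hk
      rw [f.injective.extend_apply]; exact (hw i).le
    · rw [Function.extend_apply' _ _ _ hk]; simp
  · rw [hsum]; exact hw1
  · intro k
    by_cases hk : ∃ i, f i = k
    · obtain ⟨i, rfl⟩ := hk
      rw [f.injective.extend_apply]; exact hz ⟨i, rfl⟩
    · rw [Function.extend_apply' _ _ _ hk]; exact hz0
  · rw [← hx, ← hsum]
    refine Finset.sum_congr rfl fun k _ => ?_
    by_cases hk : ∃ i, f i = k
    · obtain ⟨i, rfl⟩ := hk
      simp only [f.injective.extend_apply]
    · simp only [Function.extend_apply' _ _ _ hk]; simp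

theorem compact_hull {s : Set M4} (hne : s.Nonempty) (hs : IsCompact s) :
    IsCompact (convexHull ℝ s) := by
  have hc : IsCompact ((stdSimplex ℝ (Fin 17)) ×ˢ (Set.univ.pi fun _ : Fin 17 => s)) :=
    (isCompact_stdSimplex ℝ (Fin 17)).prod (isCompact_univ_pi fun _ => hs)
  have : convexHull ℝ s = (fun p : (Fin 17 → ℝ) × (Fin 17 → M4) => ∑ i, p.1 i • p.2 i) ''
      ((stdSimplex ℝ (Fin 17)) ×ˢ (Set.univ.pi fun _ : Fin 17 => s)) := by
    ext x
    constructor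
    · intro hx
      obtain ⟨w, hw, z, hz, h⟩ := carath hne hx
      exact ⟨(w, z), ⟨hw, fun i _ => hz i⟩, h⟩
    · rintro ⟨⟨w, z⟩, ⟨hw, hz⟩, h⟩
      exact mem_convexHull_of_exists_fintype w z hw.1 hw.2 (fun i => hz i trivial) h
  rw [this]
  exact hc.image (by fun_prop)

/-- Base of the cone. -/
def LD : Set (Fin 4 → ℝ) := {x | x 0 = 1 ∧ LC x}

theorem LD_compact : IsCompact LD := by
  apply IsCompact.of_isClosed_subset (isCompact_Icc (a := fun _ => (-1 : ℝ)) (b := fun _ => 1))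
  · have e : LD = {x : Fin 4 → ℝ | x 0 = 1} ∩ ({x | 0 ≤ x 0} ∩
        {x | x 1 ^ 2 + x 2 ^ 2 + x 3 ^ 2 ≤ x 0 ^ 2}) := rfl
    rw [e]
    refine (isClosed_eq (by fun_prop) (by fun_prop)).inter
      ((isClosed_le (by fun_prop) (by fun_prop)).inter (isClosed_le (by fun_prop) (by fun_prop)))
  · rintro x ⟨h0, -, h⟩
    rw [h0] at h
    have h1 : |x 1| ≤ 1 := abs_le_one_iff_mul_self_le_one.2 (by nlinarith [sq_nonneg (x 2), sq_nonneg (x 3)])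
    have h2 : |x 2| ≤ 1 := abs_le_one_iff_mul_self_le_one.2 (by nlinarith [sq_nonneg (x 1), sq_nonneg (x 3)])
    have h3 : |x 3| ≤ 1 := abs_le_one_iff_mul_self_le_one.2 (by nlinarith [sq_nonneg (x 2), sq_nonneg (x 1)])
    rw [abs_le] at h1 h2 h3
    constructor
    · intro i; fin_cases i
      · simp [h0]
      · exact h1.1
      · exact h2.1
      · exact h3.1
    · intro i; fin_cases i
      · simp [h0]
      · exact h1.2
      · exact h2.2
      · exact h3.2

/-- Normalized product elements. -/
def PG : Set M4 := (fun p : (Fin 4 → ℝ) × (Fin 4 → ℝ) => vecMulVec p.1 p.2) '' (LD ×ˢ LD)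

theorem PG_compact : IsCompact PG := by
  apply (LD_compact.prod LD_compact).image
  refine continuous_matrix fun i j => ?_
  simp only [vecMulVec_apply]
  fun_prop

theorem e0_LD : (Pi.single 0 1 : Fin 4 → ℝ) ∈ LD := by
  refine ⟨by simp, by simp, by simp⟩

theorem PG_ne : PG.Nonempty := ⟨_, (Pi.single 0 1, Pi.single 0 1), ⟨e0_LD, e0_LD⟩, rfl⟩

/-- Separability on the level of correlation matrices. -/
def SepT (T : M4) : Prop := ∃ (n : ℕ) (u v : Fin n → Fin 4 → ℝ),
    (∀ i, LC (u i)) ∧ (∀ i, LC (v i)) ∧ T = ∑ i, vecMulVec (u i) (v i)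

theorem hull_of_SepT {T : M4} (h : SepT T) (h1 : T 0 0 = 1) : T ∈ convexHull ℝ PG := by
  obtain ⟨n, u, v, hu, hv, hT⟩ := h
  have hs : ∑ i, u i 0 * v i 0 = 1 := by
    rw [← h1, hT, Matrix.sum_apply]; rfl
  refine mem_convexHull_of_exists_fintype (fun i => u i 0 * v i 0)
    (fun i => if u i 0 * v i 0 = 0 then vecMulVec (Pi.single 0 1) (Pi.single 0 1) else
      vecMulVec ((u i 0)⁻¹ • u i) ((v i 0)⁻¹ • v i)) (fun i => mul_nonneg (hu i).1 (hv i).1) hs ?_ ?_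
  · intro i
    split_ifs with h
    · exact ⟨(_, _), ⟨e0_LD, e0_LD⟩, rfl⟩
    · refine ⟨(_, _), ⟨?_, ?_⟩, rfl⟩
      · exact ⟨by simp [left_ne_zero_of_mul h], LC_smul (inv_nonneg.2 (hu i).1) (hu i)⟩
      · exact ⟨by simp [right_ne_zero_of_mul h], LC_smul (inv_nonneg.2 (hv i).1) (hv i)⟩
  · rw [hT]
    refine Finset.sum_congr rfl fun i _ => ?_
    split_ifs with h
    · rw [h, zero_smul]
      rcases mul_eq_zero.1 h with h | h
      · rw [LC_eq_zero (hu i) h]; simp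
      · rw [LC_eq_zero (hv i) h]; simp
    · have h1 := left_ne_zero_of_mul h
      have h2 := right_ne_zero_of_mul h
      ext j k
      simp [vecMulVec_apply]
      field_simp

theorem SepT_of_hull {T : M4} (h : T ∈ convexHull ℝ PG) : SepT T := by
  obtain ⟨w, hw, z, hz, hT⟩ := carath PG_ne h
  choose p hp hpz using hz
  refine ⟨17, fun i => w i • (p i).1, fun i => (p i).2, fun i => LC_smul (hw.1 i) (hp i).1.2,
    fun i => (hp i).2.2, ?_⟩
  rw [← hT]
  refine Finset.sum_congr rfl fun i _ => ?_
  rw [← hpz i]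
  ext j k
  simp [vecMulVec_apply, mul_assoc]

theorem SepT_smul {T : M4} {c : ℝ} (hc : 0 ≤ c) (h : SepT T) : SepT (c • T) := by
  obtain ⟨n, u, v, hu, hv, hT⟩ := h
  refine ⟨n, fun i => c • u i, v, fun i => LC_smul hc (hu i), hv, ?_⟩
  rw [hT, Finset.smul_sum]
  refine Finset.sum_congr rfl fun i _ => ?_
  rw [smul_vecMulVec]

theorem SepT_limit {T E : M4} (h1 : T 0 0 = 1) (hE : E 0 0 = 1)
    (h : ∀ ε : ℝ, 0 < ε → SepT (T + ε • E)) : SepT T := by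
  apply SepT_of_hull
  have hcl := (compact_hull PG_ne PG_compact).isClosed
  have hlim : Filter.Tendsto (fun ε : ℝ => (1 + ε)⁻¹ • (T + ε • E)) (nhdsWithin 0 (Set.Ioi 0))
      (nhds T) := by
    have hc : ContinuousAt (fun ε : ℝ => (1 + ε)⁻¹ • (T + ε • E)) 0 := by
      apply ContinuousAt.fun_smul
      · apply ContinuousAt.inv₀ (by fun_prop); simp
      · fun_prop
    have := hc.tendsto
    simp only [add_zero, inv_one, zero_smul, one_smul] at this
    exact this.mono_left nhdsWithin_le_nhds
  refine hcl.mem_of_tendsto hlim ?_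
  filter_upwards [self_mem_nhdsWithin] with ε hε
  have hε' : 0 < ε := hε
  apply hull_of_SepT (SepT_smul (by positivity) (h ε hε'))
  simp [h1, hE]
  field_simp

theorem exists_dual {m : ℕ} (N : Fin m → Fin 4 → ℝ) (r : Fin m → ℝ)
    (h : ∀ β : Fin m → ℝ, ∑ a, β a • N a = 0 → ∑ a, β a * r a = 0) :
    ∃ s : Fin 4 → ℝ, ∀ a, N a ⬝ᵥ s = r a := by
  classical
  let f : (Fin m → ℝ) →ₗ[ℝ] (Fin 4 → ℝ) := Fintype.linearCombination ℝ N
  let φ : Module.Dual ℝ (Fin m → ℝ) := Fintype.linearCombination ℝ r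
  have hφ : φ ∈ (LinearMap.ker f).dualAnnihilator := by
    rw [Submodule.mem_dualAnnihilator]
    intro β hβ
    have h1 : ∑ a, β a • N a = 0 := by
      have : f β = 0 := hβ
      rwa [Fintype.linearCombination_apply] at this
    have h2 := h β h1
    change Fintype.linearCombination ℝ r β = 0
    rw [Fintype.linearCombination_apply]
    simpa using h2
  rw [← LinearMap.range_dualMap_eq_dualAnnihilator_ker] at hφ
  obtain ⟨ψ, hψ⟩ := hφ
  refine ⟨fun j => ψ (Pi.single j 1), fun a => ?_⟩
  have h1 : ψ (N a) = r a := by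
    have := LinearMap.congr_fun hψ (Pi.single a 1)
    change ψ (Fintype.linearCombination ℝ N (Pi.single a 1)) =
      Fintype.linearCombination ℝ r (Pi.single a 1) at this
    simpa using this
  rw [← h1]
  conv_rhs => rw [← Finset.univ_sum_single (N a), map_sum]
  refine Finset.sum_congr rfl fun j _ => ?_
  rw [show (Pi.single j (N a j) : Fin 4 → ℝ) = N a j • Pi.single j 1 by
    rw [← Pi.single_smul]; simp, map_smul, smul_eq_mul]

theorem sep_eps (T : M4) (ε : ℝ) (hε : 0 < ε) (hR : LC (T *ᵥ Pi.single 0 1)) (h00 : 0 < T 0 0)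
    (h : ∀ (m : ℕ) (N : Fin m → Fin 4 → ℝ), (∀ a, LC (N a)) → (∑ a, N a = Pi.single 0 1) →
      (∀ a, 0 < (N a ᵥ* T) 0) → IsClassicalStates (stF T N)) :
    SepT (T + ε • vecMulVec (Pi.single 0 1) (T 0)) := by
  obtain ⟨m, N, hN, hsum, hpos, hdual⟩ := net ε hε
  have hp : ∀ a, 0 < (N a ᵥ* T) 0 := by
    intro a
    have h1 := hpos a _ hR (by simpa using h00)
    rwa [Matrix.dotProduct_mulVec, dotProduct_single_one] at h1
  obtain ⟨n, σ, q, hσ, hq, hst⟩ := h m N hN hsum hp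
  choose w hw using fun l => exists_HM (hσ l).1
  have hwC : ∀ l, LC (w l) := fun l => HM_psd.1 (hw l ▸ hσ l)
  set r : Fin n → Fin m → ℝ := fun l a => 2 * (N a ᵥ* T) 0 * q l a with hr
  have hNT : ∀ a, N a ᵥ* T = ∑ l, r l a • w l := by
    intro a
    apply HM_inj
    have h1 := hst a
    have h2 : HM (N a ᵥ* T) = (2 * (N a ᵥ* T) 0) • stF T N a := by
      rw [stF, smul_smul, mul_inv_cancel₀ (by have := hp a; positivity), one_smul]
    rw [h2, h1, Finset.smul_sum, map_sum]
    refine Finset.sum_congr rfl fun l _ => ?_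
    rw [map_smul, ← hw, smul_smul]
  have hrs : ∀ l, ∃ s : Fin 4 → ℝ, ∀ a, N a ⬝ᵥ s = r l a := by
    intro l
    apply exists_dual
    intro β hβ
    have h1 := (hq l).2.2 (fun a => β a * (2 * (N a ᵥ* T) 0)) (by
      have : ∀ a, (β a * (2 * (N a ᵥ* T) 0)) • stF T N a = HM ((β a • N a) ᵥ* T) := by
        intro a
        rw [stF, smul_smul, mul_assoc, mul_inv_cancel₀ (by have := hp a; positivity), mul_one,
          Matrix.smul_vecMul, map_smul]
      simp only [this]
      rw [← map_sum, ← Matrix.sum_vecMul, hβ, Matrix.zero_vecMul, map_zero])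
    rw [← h1]
    exact Finset.sum_congr rfl fun a _ => by rw [hr]; ring
  choose s hs using hrs
  have hs0 : ∀ l, 0 ≤ s l 0 ∧ s l 1 ^ 2 + s l 2 ^ 2 + s l 3 ^ 2 ≤ ((1 + ε) * s l 0) ^ 2 := by
    intro l
    apply hdual
    intro a
    rw [hs]
    exact mul_nonneg (by have := hp a; positivity) ((hq l).1 a)
  have hspan : ∀ x : Fin 4 → ℝ, (∀ a, N a ⬝ᵥ x = 0) → x = 0 := by
    intro x hx
    have h1 := hdual x (fun a => (hx a).ge)
    have h2 := hdual (-x) (fun a => by rw [dotProduct_neg, hx a, neg_zero])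
    have h0 : x 0 = 0 := le_antisymm (by simpa using h2.1) h1.1
    refine LC_eq_zero ⟨h1.1, ?_⟩ h0
    have := h1.2
    rw [h0] at this ⊢
    simpa using this
  have hT : T = ∑ l, vecMulVec (s l) (w l) := by
    rw [← sub_eq_zero]
    set D := T - ∑ l, vecMulVec (s l) (w l) with hD
    have h1 : ∀ a, N a ᵥ* D = 0 := by
      intro a
      rw [hD, Matrix.vecMul_sub, hNT, Matrix.vecMul_sum, sub_eq_zero]
      refine Finset.sum_congr rfl fun l _ => ?_
      rw [vecMul_vecMulVec, hs]
    ext i j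
    have := hspan (fun i => D i j) (fun a => congrFun (h1 a) j)
    exact congrFun this i
  refine ⟨n, fun l => s l + (ε * s l 0) • Pi.single 0 1, w, ?_, hwC, ?_⟩
  · intro l
    obtain ⟨h1, h2⟩ := hs0 l
    refine ⟨?_, ?_⟩
    · simp; positivity
    · simp
      nlinarith
  · have hT0 : T 0 = ∑ l, s l 0 • w l := by
      have : T 0 = (∑ l, vecMulVec (s l) (w l)) 0 := by rw [← hT]
      rw [this]
      ext j
      simp [Matrix.sum_apply, vecMulVec_apply]
    rw [hT0]
    conv_lhs => rw [hT]
    ext i j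
    simp only [Matrix.add_apply, Matrix.sum_apply, Matrix.smul_apply, vecMulVec_apply,
      Pi.add_apply, Pi.smul_apply, Finset.sum_apply, smul_eq_mul, Finset.mul_sum,
      ← Finset.sum_add_distrib]
    exact Finset.sum_congr rfl fun l _ => by ring

theorem SepT_iff {T : M4} : Separable (KM T) ↔ SepT T := by
  constructor
  · rintro ⟨n, σ, τ, hσ, hτ, h⟩
    choose u hu using fun i => exists_HM (hσ i).1
    choose v hv using fun i => exists_HM (hτ i).1
    refine ⟨n, u, v, fun i => HM_psd.1 (hu i ▸ hσ i), fun i => HM_psd.1 (hv i ▸ hτ i), ?_⟩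
    apply KM_inj
    rw [h, map_sum]
    exact Finset.sum_congr rfl fun i _ => by rw [KM_vec, ← hu, ← hv]
  · rintro ⟨n, u, v, hu, hv, h⟩
    refine ⟨n, fun i => HM (u i), fun i => HM (v i), fun i => HM_psd.2 (hu i),
      fun i => HM_psd.2 (hv i), ?_⟩
    rw [h, map_sum]
    exact Finset.sum_congr rfl fun i _ => KM_vec _ _

theorem marg_LC {T : M4} (h : (KM T).PosSemidef) : LC (T *ᵥ Pi.single 0 1) := by
  have h1 : (∑ k : Fin 2, (KM T).submatrix (fun i => (i, k)) (fun i => (i, k))).PosSemidef :=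
    Matrix.posSemidef_sum _ fun k _ => h.submatrix _
  have h2 : ∑ k : Fin 2, (KM T).submatrix (fun i => (i, k)) (fun i => (i, k)) =
      HM ((2 : ℝ) • (T *ᵥ Pi.single 0 1)) := by
    rw [KM_rows, HM_apply]
    ext a b
    simp only [Matrix.sum_apply, Matrix.submatrix_apply, Matrix.kroneckerMap_apply]
    rw [Finset.sum_comm]
    refine Finset.sum_congr rfl fun i _ => ?_
    rw [← Finset.mul_sum]
    change Pa i a b * (HM (T i)).trace = _
    rw [HM_trace]
    simp
    ring
  rw [h2] at h1
  have h3 := LC_smul (by norm_num : (0 : ℝ) ≤ 1 / 2) (HM_psd.1 h1)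
  rw [smul_smul] at h3
  simpa using h3

theorem entangled_iff_steerable_to_nonclassical_states
    (ρ : Matrix (Fin 2 × Fin 2) (Fin 2 × Fin 2) ℂ)
    (hpsd : ρ.PosSemidef) (htr : ρ.trace = 1) :
    ¬ Separable ρ ↔
      ∃ (m : ℕ) (N : Fin m → Matrix (Fin 2) (Fin 2) ℂ),
        (∀ a, (N a).PosSemidef) ∧ (∑ a, N a = 1) ∧
        (∀ a, 0 < (steeredState ρ (N a)).trace.re) ∧
        ¬ IsClassicalStates
          (fun a : Fin m => ((steeredState ρ (N a)).trace.re)⁻¹ • steeredState ρ (N a)) := by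
  obtain ⟨T, rfl⟩ := exists_KM hpsd.1
  have h00 : T 0 0 = 1 / 4 := by
    rw [KM_trace] at htr
    have : 4 * T 0 0 = 1 := by exact_mod_cast htr
    linarith
  have h00p : 0 < T 0 0 := by rw [h00]; norm_num
  rw [SepT_iff]
  constructor
  · intro hns
    by_contra hcon
    apply hns
    have hcl : ∀ (m : ℕ) (N : Fin m → Fin 4 → ℝ), (∀ a, LC (N a)) →
        (∑ a, N a = Pi.single 0 1) → (∀ a, 0 < (N a ᵥ* T) 0) →
        IsClassicalStates (stF T N) := by
      intro m N hN hsum hp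
      by_contra hnc
      apply hcon
      refine ⟨m, fun a => HM (N a), fun a => HM_psd.2 (hN a), ?_, ?_, ?_⟩
      · rw [← map_sum, hsum, HM_e0]
      · intro a
        rw [steered_form]
        exact mul_pos (by norm_num) (hp a)
      · rwa [states_form]
    have h4 : SepT ((4 : ℝ) • T) := by
      apply SepT_limit (E := (4 : ℝ) • vecMulVec (Pi.single 0 1) (T 0))
      · simp [h00]
      · simp [vecMulVec_apply, h00]
      · intro ε hε
        have := SepT_smul (by norm_num : (0 : ℝ) ≤ 4) (sep_eps T ε hε (marg_LC hpsd) h00p hcl)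
        rwa [smul_add, smul_comm] at this
    have h5 := SepT_smul (by norm_num : (0 : ℝ) ≤ 1 / 4) h4
    rw [smul_smul] at h5
    norm_num at h5
    exact h5
  · rintro ⟨m, N, hN, hsum, hp, hnc⟩ ⟨n, u, v, hu, hv, hT⟩
    choose x hx using fun a => exists_HM (hN a).1
    obtain rfl : N = fun a => HM (x a) := funext hx
    apply hnc
    rw [states_form]
    apply classical_of_sep T h00p u v hu hv hT _ x (fun a => HM_psd.1 (hN a))
    · intro a
      have := hp a
      rw [steered_form] at this
      linarith
    · rcases Nat.eq_zero_or_pos m with rfl | h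
      · simp at hsum
      · exact h
end
end
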